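/- Let e₃ ∈ C²(ℝ) and let θ : ℝ³ × ℝ → ℝ be C². Fix t ∈ (0,T), and let ψ ∈ C¹(ℝ³) be such that there is a compact set K ⊂ U with ψ(x̂(X,t)) = 0 for all X ∈ U \ K. For ε ∈ (−1,1) set E_TD[θ + εψ](t) = −∫_{Γ(t)} ½ e₃(|grad_Γ(θ + εψ)|²) dH². Then (d/dε)|_{ε=0} E_TD[θ + εψ](t) = ∫_{Γ(t)} div_Γ{ e₃'(|grad_Γ θ|²) grad_Γ θ } ψ dH². -/

import Mathlib

noncomputable section
open MeasureTheory

/-- ℝ² with the Euclidean structure. -/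
abbrev E2 : Type := EuclideanSpace ℝ (Fin 2)
/-- ℝ³ with the Euclidean structure. -/
abbrev E3 : Type := EuclideanSpace ℝ (Fin 3)

/-- The cross product on ℝ³. -/
def cross3 (a b : E3) : E3 :=
  (EuclideanSpace.equiv (Fin 3) ℝ).symm
    ![a 1 * b 2 - a 2 * b 1, a 2 * b 0 - a 0 * b 2, a 0 * b 1 - a 1 * b 0]

/-- The dot product on ℝ³. -/
def dot3 (a b : E3) : ℝ := ∑ i, a i * b i

/-- The tangent vector `g_α = ∂x̂/∂X_α` of the parametrization `x̂` at `(X, t)`. -/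
def gVec (xh : E2 × ℝ → E3) (α : Fin 2) (X : E2) (t : ℝ) : E3 :=
  fderiv ℝ (fun Y : E2 => xh (Y, t)) X (EuclideanSpace.single α 1)

/-- The Riemannian metric `g_{αβ} = g_α · g_β`. -/
def gMet (xh : E2 × ℝ → E3) (α β : Fin 2) (X : E2) (t : ℝ) : ℝ :=
  dot3 (gVec xh α X t) (gVec xh β X t)

/-- The Gram determinant `G = g₁₁ g₂₂ − g₁₂ g₂₁`. -/
def Gdet (xh : E2 × ℝ → E3) (X : E2) (t : ℝ) : ℝ :=
  gMet xh 0 0 X t * gMet xh 1 1 X t - gMet xh 0 1 X t * gMet xh 1 0 X t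

/-- The inverse metric `(g^{αβ}) = (g_{αβ})⁻¹`. -/
def gInv (xh : E2 × ℝ → E3) (X : E2) (t : ℝ) : Matrix (Fin 2) (Fin 2) ℝ :=
  (Matrix.of fun α β => gMet xh α β X t)⁻¹

/-- The raised tangent vector `g^α = Σ_β g^{αβ} g_β`. -/
def gVecUp (xh : E2 × ℝ → E3) (α : Fin 2) (X : E2) (t : ℝ) : E3 :=
  ∑ β, gInv xh X t α β • gVec xh β X t

/-- The unit normal `n̂ = (g₁ × g₂)/|g₁ × g₂|` of the parametrized surface. -/
def nHat (xh : E2 × ℝ → E3) (X : E2) (t : ℝ) : E3 :=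
  ‖cross3 (gVec xh 0 X t) (gVec xh 1 X t)‖⁻¹ • cross3 (gVec xh 0 X t) (gVec xh 1 X t)

/-- Spatial partial derivative `∂f/∂x_j` at `(x, t)`. -/
def pdx (j : Fin 3) (f : E3 × ℝ → ℝ) (x : E3) (t : ℝ) : ℝ :=
  fderiv ℝ (fun y : E3 => f (y, t)) x (EuclideanSpace.single j 1)

/-- Time partial derivative `∂f/∂t` at `(x, t)`. -/
def pdt (f : E3 × ℝ → ℝ) (x : E3) (t : ℝ) : ℝ := deriv (fun s => f (x, s)) t

/-- Tangential derivative `∂_j^Γ f = Σ_i (δ_{ij} − N_i N_j) ∂f/∂x_i`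
with normal extension `N`. -/
def tder (N : E3 × ℝ → E3) (j : Fin 3) (f : E3 × ℝ → ℝ) (x : E3) (t : ℝ) : ℝ :=
  ∑ i, ((if i = j then (1 : ℝ) else 0) - N (x, t) i * N (x, t) j) * pdx i f x t

/-- Surface gradient `grad_Γ f = (∂_1^Γ f, ∂_2^Γ f, ∂_3^Γ f)`. -/
def sgrad (N : E3 × ℝ → E3) (f : E3 × ℝ → ℝ) (x : E3) (t : ℝ) : E3 :=
  (EuclideanSpace.equiv (Fin 3) ℝ).symm fun j => tder N j f x t

/-- Surface divergence `div_Γ φ = Σ_j ∂_j^Γ φ_j`. -/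
def sdiv (N : E3 × ℝ → E3) (φ : E3 × ℝ → E3) (x : E3) (t : ℝ) : ℝ :=
  ∑ j, tder N j (fun p => φ p j) x t

/-- Row-wise surface divergence of a matrix field: `(div_Γ M)_i = Σ_j ∂_j^Γ M_{ij}`. -/
def sdivM (N : E3 × ℝ → E3) (M : E3 × ℝ → Matrix (Fin 3) (Fin 3) ℝ) (x : E3) (t : ℝ) : E3 :=
  (EuclideanSpace.equiv (Fin 3) ℝ).symm fun i => ∑ j, tder N j (fun p => M p i j) x t

/-- The orthogonal projection matrix `P_Γ = I − N ⊗ N`. -/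
def Pmat (N : E3 × ℝ → E3) (x : E3) (t : ℝ) : Matrix (Fin 3) (Fin 3) ℝ :=
  Matrix.of fun i j => (if i = j then (1 : ℝ) else 0) - N (x, t) i * N (x, t) j

/-- The symmetric gradient `D(φ) = ((∇φ) + (∇φ)ᵀ)/2`. -/
def Dmat (φ : E3 × ℝ → E3) (x : E3) (t : ℝ) : Matrix (Fin 3) (Fin 3) ℝ :=
  Matrix.of fun i j => (pdx i (fun p => φ p j) x t + pdx j (fun p => φ p i) x t) / 2

/-- The surface stretching tensor `D_Γ(φ) = P_Γ D(φ) P_Γ`. -/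
def DGam (N : E3 × ℝ → E3) (φ : E3 × ℝ → E3) (x : E3) (t : ℝ) : Matrix (Fin 3) (Fin 3) ℝ :=
  Pmat N x t * Dmat φ x t * Pmat N x t

/-- The squared Frobenius norm `|M|² = Σ_{i,j} M_{ij}²`. -/
def frob2 (M : Matrix (Fin 3) (Fin 3) ℝ) : ℝ := ∑ i, ∑ j, (M i j) ^ 2

/-- The material derivative `D_t f = ∂_t f + (v · ∇)f`. -/
def Dt (v : E3 × ℝ → E3) (f : E3 × ℝ → ℝ) (x : E3) (t : ℝ) : ℝ :=
  pdt f x t + ∑ i, v (x, t) i * pdx i f x t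

/-- Matrix-vector product on ℝ³. -/
def mulVec3 (M : Matrix (Fin 3) (Fin 3) ℝ) (w : E3) : E3 :=
  (EuclideanSpace.equiv (Fin 3) ℝ).symm (M.mulVec fun i => w i)

open Filter Topology Module
open scoped NNReal ENNReal

section AreaFormula

theorem hausdorffMeasure_image_le_of_edist_le {X Y Z : Type*} [EMetricSpace Y] [EMetricSpace Z]
    [MeasurableSpace Y] [BorelSpace Y] [MeasurableSpace Z] [BorelSpace Z]
    {f : X → Y} {g : X → Z} {s : Set X} {C : ℝ≥0}
    (h : ∀ x ∈ s, ∀ y ∈ s, edist (f x) (f y) ≤ C * edist (g x) (g y)) {d : ℝ} (hd : 0 ≤ d) :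
    μH[d] (f '' s) ≤ (C : ℝ≥0∞) ^ d * μH[d] (g '' s) := by
  classical
  rcases s.eq_empty_or_nonempty with rfl | ⟨x₀, -⟩
  · simp
  have : Nonempty X := ⟨x₀⟩
  set k : Z → X := Function.invFunOn g s
  have hk : ∀ x ∈ s, k (g x) ∈ s ∧ g (k (g x)) = g x := fun x hx =>
    Function.invFunOn_pos ⟨x, hx, rfl⟩
  have hfk : ∀ x ∈ s, f (k (g x)) = f x := fun x hx => by
    have := h _ (hk x hx).1 x hx
    simpa [(hk x hx).2] using this
  have himg : f '' s = (f ∘ k) '' (g '' s) := by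
    rw [Set.image_image]
    exact Set.image_congr fun x hx => (hfk x hx).symm
  have hlip : LipschitzOnWith C (f ∘ k) (g '' s) := by
    rintro _ ⟨x, hx, rfl⟩ _ ⟨y, hy, rfl⟩
    simpa [hfk x hx, hfk y hy] using h x hx y hy
  rw [himg]
  exact hlip.hausdorffMeasure_image_le hd

theorem ContDiff.exists_lipschitzOnWith_of_isBounded {E V : Type*}
    [NormedAddCommGroup E] [NormedSpace ℝ E] [FiniteDimensional ℝ E]
    [NormedAddCommGroup V] [NormedSpace ℝ V] {F : E → V} (hF : ContDiff ℝ 1 F) {U : Set E}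
    (hU : Bornology.IsBounded U) : ∃ C, LipschitzOnWith C F U := by
  obtain ⟨R, hR⟩ := hU.subset_closedBall 0
  obtain ⟨M, hM⟩ := (isCompact_closedBall (0 : E) R).exists_bound_of_continuousOn
    (hF.continuous_fderiv one_ne_zero).continuousOn
  refine ⟨M.toNNReal, LipschitzOnWith.mono ?_ hR⟩
  refine (convex_closedBall (0 : E) R).lipschitzOnWith_of_nnnorm_fderiv_le (𝕜 := ℝ)
    (fun x _ => (hF.differentiable one_ne_zero) x) fun x hx => ?_
  rw [← NNReal.coe_le_coe]
  exact (hM x hx).trans (Real.le_coe_toNNReal M)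

variable {E V : Type*} [NormedAddCommGroup E] [InnerProductSpace ℝ E] [FiniteDimensional ℝ E]
  [MeasurableSpace E] [BorelSpace E] [NormedAddCommGroup V] [InnerProductSpace ℝ V]
  [MeasurableSpace V] [BorelSpace V]

theorem HasStrictFDerivAt.eventually_hausdorffMeasure_image_le {F : E → V} {L : E →L[ℝ] V} {x : E}
    (hF : HasStrictFDerivAt F L x) (hL : Function.Injective L) {C : ℝ≥0} (hC : 1 < C) :
    ∃ s ∈ 𝓝 x, ∀ B ⊆ s,
      μH[finrank ℝ E] (F '' B) ≤ (C : ℝ≥0∞) ^ (finrank ℝ E : ℝ) *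
        (ENNReal.ofReal (L : E →ₗ[ℝ] V).normDet * μH[finrank ℝ E] B) ∧
      ENNReal.ofReal (L : E →ₗ[ℝ] V).normDet * μH[finrank ℝ E] B ≤
        (C : ℝ≥0∞) ^ (finrank ℝ E : ℝ) * μH[finrank ℝ E] (F '' B) := by
  obtain ⟨κ, hκ, hanti⟩ := (L : E →ₗ[ℝ] V).exists_antilipschitzWith (LinearMap.ker_eq_bot.2 hL)
  have hC0 : (0 : ℝ) < C := by positivity
  have hC1 : (1 : ℝ) < C := by exact_mod_cast hC
  set c : ℝ := 1 - 1 / C with hc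
  have hc0 : 0 < c := by
    rw [hc, sub_pos, div_lt_one hC0]; exact hC1
  have hκ' : (0 : ℝ) < κ := by exact_mod_cast hκ
  have hδ : 0 < c / κ := by positivity
  obtain ⟨s, hs, happ⟩ := hF.approximates_deriv_on_nhds (c := ⟨c / κ, hδ.le⟩) (Or.inr hδ)
  have hdiff : ∀ y ∈ s, ∀ z ∈ s, ‖F y - F z - L (y - z)‖ ≤ c * ‖L (y - z)‖ := by
    intro y hy z hz
    refine (happ y hy z hz).trans ?_
    have h1 : ‖y - z‖ ≤ κ * ‖L (y - z)‖ := by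
      have := hanti.le_mul_dist (y - z) 0
      simpa using this
    calc (c / κ) * ‖y - z‖ ≤ (c / κ) * (κ * ‖L (y - z)‖) := by gcongr
      _ = c * ‖L (y - z)‖ := by field_simp
  have hCc : C * (1 - c) = 1 := by rw [hc]; field_simp; ring
  have hupper : ∀ y ∈ s, ∀ z ∈ s, edist (F y) (F z) ≤ C * edist (L y) (L z) := by
    intro y hy z hz
    rw [edist_nndist, edist_nndist]
    norm_cast
    rw [← NNReal.coe_le_coe, NNReal.coe_mul, coe_nndist, coe_nndist, dist_eq_norm, dist_eq_norm,
      ← map_sub]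
    have h2 : ‖F y - F z‖ ≤ ‖F y - F z - L (y - z)‖ + ‖L (y - z)‖ := by
      simpa using norm_add_le (F y - F z - L (y - z)) (L (y - z))
    have h3 := hdiff y hy z hz
    have h4 : 1 + c ≤ C := by nlinarith
    nlinarith [norm_nonneg (L (y - z))]
  have hlower : ∀ y ∈ s, ∀ z ∈ s, edist (L y) (L z) ≤ C * edist (F y) (F z) := by
    intro y hy z hz
    rw [edist_nndist, edist_nndist]
    norm_cast
    rw [← NNReal.coe_le_coe, NNReal.coe_mul, coe_nndist, coe_nndist, dist_eq_norm, dist_eq_norm,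
      ← map_sub]
    have h2 : ‖L (y - z)‖ ≤ ‖F y - F z‖ + ‖F y - F z - L (y - z)‖ := by
      simpa using norm_sub_le (F y - F z) (F y - F z - L (y - z))
    have h3 := hdiff y hy z hz
    have h4 : (1 - c) * ‖L (y - z)‖ ≤ ‖F y - F z‖ := by linarith
    have := mul_le_mul_of_nonneg_left h4 hC0.le
    rwa [← mul_assoc, hCc, one_mul] at this
  refine ⟨s, hs, fun B hB => ?_⟩
  rw [← LinearMap.hausdorffMeasure_image]
  exact ⟨hausdorffMeasure_image_le_of_edist_le
      (fun y hy z hz => hupper y (hB hy) z (hB hz)) (by positivity),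
    hausdorffMeasure_image_le_of_edist_le
      (fun y hy z hz => hlower y (hB hy) z (hB hz)) (by positivity)⟩

variable {U : Set E} {F : E → V}

theorem hausdorffMeasure_image_lt_top (hUb : Bornology.IsBounded U) (hF : ContDiff ℝ 1 F) :
    μH[finrank ℝ E] (F '' U) < ∞ := by
  obtain ⟨C, hC⟩ := hF.exists_lipschitzOnWith_of_isBounded hUb
  refine (hC.hausdorffMeasure_image_le (by positivity)).trans_lt ?_
  exact ENNReal.mul_lt_top (ENNReal.rpow_lt_top_of_nonneg (by positivity) (by simp))
    hUb.measure_lt_top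

theorem hausdorffMeasure_image_eq_withDensity (hU : IsOpen U) (hUb : Bornology.IsBounded U)
    (hF : ContDiff ℝ 1 F) (hinj : Set.InjOn F U)
    (himm : ∀ x ∈ U, Function.Injective (fderiv ℝ F x)) :
    ((μH[finrank ℝ E] : Measure V).comap (U.domRestrict F)).map Subtype.val =
      ((μH[finrank ℝ E] : Measure E).restrict U).withDensity
        fun x => ENNReal.ofReal (fderiv ℝ F x : E →ₗ[ℝ] V).normDet := by
  set μ : Measure E := μH[finrank ℝ E] with hμ
  have hemb : MeasurableEmbedding (U.domRestrict F) :=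
    hF.continuous.continuousOn.measurableEmbedding hU.measurableSet hinj
  set ν := ((μH[finrank ℝ E] : Measure V).comap (U.domRestrict F)).map Subtype.val with hν
  have hνapply : ∀ B, MeasurableSet B → ν B = μH[finrank ℝ E] (F '' (U ∩ B)) := by
    intro B hB
    rw [hν, Measure.map_apply measurable_subtype_coe hB, hemb.comap_apply]
    congr 1
    rw [Set.domRestrict_eq, Set.image_comp, Subtype.image_preimage_coe]
  obtain ⟨C, hC⟩ := hF.exists_lipschitzOnWith_of_isBounded hUb
  have hac : ν ≪ μ := by
    refine Measure.AbsolutelyContinuous.mk fun B hB h0 => ?_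
    rw [hνapply B hB]
    refine le_antisymm (((hC.mono Set.inter_subset_left).hausdorffMeasure_image_le
      (by positivity)).trans ?_) zero_le
    rw [measure_mono_null Set.inter_subset_right h0, mul_zero]
  have : IsFiniteMeasure ν := ⟨by
    rw [hνapply _ MeasurableSet.univ, Set.inter_univ]
    exact hausdorffMeasure_image_lt_top hUb hF⟩
  have hderiv : ν.rnDeriv μ =ᵐ[μ.restrict U]
      fun x => ENNReal.ofReal (fderiv ℝ F x : E →ₗ[ℝ] V).normDet := by
    filter_upwards [ae_restrict_of_ae (Besicovitch.ae_tendsto_rnDeriv ν μ),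
      ae_restrict_mem hU.measurableSet] with x hx hxU
    set J := ENNReal.ofReal (fderiv ℝ F x : E →ₗ[ℝ] V).normDet
    have hball : ∀ C : ℝ≥0, 1 < C → ∀ᶠ r in 𝓝[>] (0 : ℝ),
        ν (Metric.closedBall x r) / μ (Metric.closedBall x r) ≤
            (C : ℝ≥0∞) ^ (finrank ℝ E : ℝ) * J ∧
          J ≤ (C : ℝ≥0∞) ^ (finrank ℝ E : ℝ) *
            (ν (Metric.closedBall x r) / μ (Metric.closedBall x r)) := by
      intro C hC
      obtain ⟨s, hs, hsB⟩ := (hF.hasStrictFDerivAt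
        one_ne_zero (x := x)).eventually_hausdorffMeasure_image_le (himm x hxU) hC
      obtain ⟨ρ, hρ, hρs⟩ := Metric.nhds_basis_closedBall.mem_iff.1
        (Filter.inter_mem hs (hU.mem_nhds hxU))
      filter_upwards [Ioc_mem_nhdsGT hρ] with r hr
      have hsub : Metric.closedBall x r ⊆ s ∩ U :=
        (Metric.closedBall_subset_closedBall hr.2).trans hρs
      have h1 := hsB _ (hsub.trans Set.inter_subset_left)
      have hνB : ν (Metric.closedBall x r) = μH[finrank ℝ E] (F '' Metric.closedBall x r) := by
        rw [hνapply _ Metric.isClosed_closedBall.measurableSet,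
          Set.inter_eq_right.2 (hsub.trans Set.inter_subset_right)]
      have hpos : μ (Metric.closedBall x r) ≠ 0 := (Metric.measure_closedBall_pos μ x hr.1).ne'
      have hfin : μ (Metric.closedBall x r) ≠ ∞ := measure_closedBall_lt_top.ne
      rw [hνB]
      constructor
      · rw [ENNReal.div_le_iff hpos hfin, mul_assoc]
        exact h1.1
      · rw [← mul_div_assoc, ENNReal.le_div_iff_mul_le (Or.inl hpos) (Or.inl hfin)]
        exact h1.2
    have hlim : ∀ a : ℝ≥0∞, Tendsto (fun C : ℝ≥0 => (C : ℝ≥0∞) ^ (finrank ℝ E : ℝ) * a)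
        (𝓝[>] 1) (𝓝 a) := by
      intro a
      have h1 : Tendsto (fun C : ℝ≥0 => (C : ℝ≥0∞) ^ (finrank ℝ E : ℝ)) (𝓝[>] 1) (𝓝 1) := by
        have : Continuous fun C : ℝ≥0 => (C : ℝ≥0∞) ^ (finrank ℝ E : ℝ) :=
          ENNReal.continuous_rpow_const.comp ENNReal.continuous_coe
        simpa using (this.tendsto 1).mono_left nhdsWithin_le_nhds
      simpa using ENNReal.Tendsto.mul_const h1 (Or.inl one_ne_zero)
    refine le_antisymm (ge_of_tendsto (hlim J) ?_) (ge_of_tendsto (hlim _) ?_)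
    · filter_upwards [self_mem_nhdsWithin] with C hC
      exact le_of_tendsto hx ((hball C hC).mono fun r hr => hr.1)
    · filter_upwards [self_mem_nhdsWithin] with C hC
      refine ge_of_tendsto (ENNReal.Tendsto.const_mul hx (Or.inr ?_))
        ((hball C hC).mono fun r hr => hr.2)
      exact ENNReal.rpow_ne_top_of_nonneg (by positivity) (by simp)
  have hνU : ν.restrict U = ν := by
    refine Measure.restrict_eq_self_of_ae_mem ?_
    rw [ae_iff]
    change ν Uᶜ = 0
    rw [hνapply _ hU.measurableSet.compl]
    simp
  rw [← withDensity_congr_ae hderiv, ← restrict_withDensity hU.measurableSet,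
    Measure.withDensity_rnDeriv_eq _ _ hac, hνU]

theorem integral_image_hausdorffMeasure (hU : IsOpen U) (hUb : Bornology.IsBounded U)
    (hF : ContDiff ℝ 1 F) (hinj : Set.InjOn F U)
    (himm : ∀ x ∈ U, Function.Injective (fderiv ℝ F x))
    {J : E → ℝ} (hJ : Continuous J) (hJF : ∀ x ∈ U, J x = (fderiv ℝ F x : E →ₗ[ℝ] V).normDet)
    (f : V → ℝ) :
    ∫ y in F '' U, f y ∂(μH[finrank ℝ E] : Measure V) =
      ∫ x in U, J x * f (F x) ∂(μH[finrank ℝ E] : Measure E) := by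
  have hemb : MeasurableEmbedding (U.domRestrict F) :=
    hF.continuous.continuousOn.measurableEmbedding hU.measurableSet hinj
  have hden : ((μH[finrank ℝ E] : Measure V).comap (U.domRestrict F)).map Subtype.val =
      ((μH[finrank ℝ E] : Measure E).restrict U).withDensity fun x => ENNReal.ofReal (J x) := by
    rw [hausdorffMeasure_image_eq_withDensity hU hUb hF hinj himm]
    refine withDensity_congr_ae ?_
    filter_upwards [ae_restrict_mem hU.measurableSet] with x hx
    rw [hJF x hx]
  have h1 : ∫ y in F '' U, f y ∂(μH[finrank ℝ E] : Measure V) =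
      ∫ x, f (F x) ∂(((μH[finrank ℝ E] : Measure V).comap (U.domRestrict F)).map Subtype.val) := by
    rw [(MeasurableEmbedding.subtype_coe hU.measurableSet).integral_map, ← Set.range_domRestrict,
      ← hemb.map_comap, hemb.integral_map]
    rfl
  rw [h1, hden, integral_withDensity_eq_integral_toReal_smul
    (by fun_prop) (by simp)]
  refine setIntegral_congr_fun hU.measurableSet fun x hx => ?_
  have : 0 ≤ J x := by rw [hJF x hx]; exact LinearMap.normDet_nonneg _
  simp [ENNReal.toReal_ofReal this]

end AreaFormula

section Algebra

@[simp] theorem cross3_apply_zero (a b : E3) : cross3 a b 0 = a 1 * b 2 - a 2 * b 1 := rfl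
@[simp] theorem cross3_apply_one (a b : E3) : cross3 a b 1 = a 2 * b 0 - a 0 * b 2 := rfl
@[simp] theorem cross3_apply_two (a b : E3) : cross3 a b 2 = a 0 * b 1 - a 1 * b 0 := rfl

theorem dot3_eq (a b : E3) : dot3 a b = a 0 * b 0 + a 1 * b 1 + a 2 * b 2 := by
  simp [dot3, Fin.sum_univ_three]

theorem inner_eq_dot3 (a b : E3) : inner ℝ a b = dot3 a b := by
  simp [PiLp.inner_apply, dot3, mul_comm]

theorem dot3_self_eq_norm_sq (a : E3) : dot3 a a = ‖a‖ ^ 2 := by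
  rw [← inner_eq_dot3, real_inner_self_eq_norm_sq]

/-- The triple product on ℝ³. -/
def det3 (a b c : E3) : ℝ := dot3 (cross3 a b) c

theorem det3_eq (a b c : E3) : det3 a b c =
    (a 1 * b 2 - a 2 * b 1) * c 0 + (a 2 * b 0 - a 0 * b 2) * c 1
      + (a 0 * b 1 - a 1 * b 0) * c 2 := by
  simp [det3, dot3_eq]

theorem det3_eq_zero_of_orthogonal {a b c n : E3} (hn : dot3 n n = 1) (ha : dot3 a n = 0)
    (hb : dot3 b n = 0) (hc : dot3 c n = 0) : det3 a b c = 0 := by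
  have hbc := det3_eq b c n
  have hca := det3_eq c a n
  have hab := det3_eq a b n
  rw [dot3_eq] at *
  rw [det3_eq]
  linear_combination
    (-((a 1 * b 2 - a 2 * b 1) * c 0 + (a 2 * b 0 - a 0 * b 2) * c 1
      + (a 0 * b 1 - a 1 * b 0) * c 2)) * hn
    + ((b 1 * c 2 - b 2 * c 1) * n 0 + (b 2 * c 0 - b 0 * c 2) * n 1
      + (b 0 * c 1 - b 1 * c 0) * n 2) * ha
    + ((c 1 * a 2 - c 2 * a 1) * n 0 + (c 2 * a 0 - c 0 * a 2) * n 1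
      + (c 0 * a 1 - c 1 * a 0) * n 2) * hb
    + ((a 1 * b 2 - a 2 * b 1) * n 0 + (a 2 * b 0 - a 0 * b 2) * n 1
      + (a 0 * b 1 - a 1 * b 0) * n 2) * hc

theorem E3.eq_sum_single (v : E3) : v = ∑ i, v i • EuclideanSpace.single i (1 : ℝ) := by
  ext j
  fin_cases j <;> simp [Fin.sum_univ_three]

theorem clm_apply_eq_sum {W : Type*} [NormedAddCommGroup W] [NormedSpace ℝ W] (A : E3 →L[ℝ] W)
    (v : E3) : A v = ∑ i, v i • A (EuclideanSpace.single i 1) := by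
  conv_lhs => rw [E3.eq_sum_single v]
  simp

/-- The trace of the tangential part of a linear map, with normal `n`. -/
def tangentialTrace (n : E3) (A : E3 →L[ℝ] E3) : ℝ :=
  ∑ j, ∑ i, ((if i = j then (1 : ℝ) else 0) - n i * n j) * A (EuclideanSpace.single i 1) j

theorem det3_map_add_det3_map {p q n : E3} {J : ℝ} (hn : dot3 n n = 1)
    (hpq : cross3 p q = J • n) (A : E3 →L[ℝ] E3) :
    det3 (A p) q n + det3 p (A q) n = J * tangentialTrace n A := by
  have h0 := congrArg (fun v : E3 => v 0) hpq
  have h1 := congrArg (fun v : E3 => v 1) hpq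
  have h2 := congrArg (fun v : E3 => v 2) hpq
  have hA : ∀ v : E3, ∀ j, A v j = v 0 * A (EuclideanSpace.single 0 1) j
      + v 1 * A (EuclideanSpace.single 1 1) j + v 2 * A (EuclideanSpace.single 2 1) j := by
    intro v j
    rw [clm_apply_eq_sum A v]
    simp [Fin.sum_univ_three]
  simp only [cross3_apply_zero, cross3_apply_one, cross3_apply_two, PiLp.smul_apply,
    smul_eq_mul] at h0 h1 h2
  rw [dot3_eq] at hn
  simp only [det3_eq, hA p, hA q, tangentialTrace, Fin.sum_univ_three]
  simp only [Fin.isValue, reduceIte, Fin.reduceEq]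
  generalize A (EuclideanSpace.single 0 1) = a
  generalize A (EuclideanSpace.single 1 1) = b
  generalize A (EuclideanSpace.single 2 1) = c
  linear_combination
    ((a 0 + b 1 + c 2) * n 0 - (n 0 * a 0 + n 1 * b 0 + n 2 * c 0)) * h0
    + ((a 0 + b 1 + c 2) * n 1 - (n 0 * a 1 + n 1 * b 1 + n 2 * c 1)) * h1
    + ((a 0 + b 1 + c 2) * n 2 - (n 0 * a 2 + n 1 * b 2 + n 2 * c 2)) * h2
    + J * (a 0 + b 1 + c 2) * hn

theorem det3_smul_add_det3_smul {p q n w : E3} {J : ℝ} (hn : dot3 n n = 1)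
    (hpq : cross3 p q = J • n) (hw : dot3 w n = 0) :
    det3 w q n • p + det3 p w n • q = J • w := by
  have h0 := congrArg (fun v : E3 => v 0) hpq
  have h1 := congrArg (fun v : E3 => v 1) hpq
  have h2 := congrArg (fun v : E3 => v 2) hpq
  simp only [cross3_apply_zero, cross3_apply_one, cross3_apply_two, PiLp.smul_apply,
    smul_eq_mul] at h0 h1 h2
  rw [dot3_eq] at hn hw
  ext k
  have key : det3 w q n * p k + det3 p w n * q k = w k * det3 p q n - n k * det3 p q w := by
    simp only [det3_eq]
    fin_cases k <;> simp <;> ring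
  have e1 : det3 p q n = J := by
    rw [det3_eq]; linear_combination n 0 * h0 + n 1 * h1 + n 2 * h2 + J * hn
  have e2 : det3 p q w = 0 := by
    rw [det3_eq]; linear_combination w 0 * h0 + w 1 * h1 + w 2 * h2 + J * hw
  rw [e1, e2] at key
  simp only [PiLp.add_apply, PiLp.smul_apply, smul_eq_mul]
  linarith

theorem HasFDerivAt.euclidean_apply {E ι : Type*} [NormedAddCommGroup E] [NormedSpace ℝ E]
    [Fintype ι] {a : E → EuclideanSpace ℝ ι} {a' : E →L[ℝ] EuclideanSpace ℝ ι} {x : E}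
    (ha : HasFDerivAt a a' x) (i : ι) :
    HasFDerivAt (fun y => a y i) ((EuclideanSpace.proj i : EuclideanSpace ℝ ι →L[ℝ] ℝ) ∘L a') x :=
  (EuclideanSpace.proj i : EuclideanSpace ℝ ι →L[ℝ] ℝ).hasFDerivAt.comp x ha

theorem fderiv_det3 {E : Type*} [NormedAddCommGroup E] [NormedSpace ℝ E] {a b c : E → E3} {x : E}
    (ha : DifferentiableAt ℝ a x) (hb : DifferentiableAt ℝ b x) (hc : DifferentiableAt ℝ c x)
    (v : E) :
    fderiv ℝ (fun y => det3 (a y) (b y) (c y)) x v =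
      det3 (fderiv ℝ a x v) (b x) (c x) + det3 (a x) (fderiv ℝ b x v) (c x)
        + det3 (a x) (b x) (fderiv ℝ c x v) := by
  have hA := ha.hasFDerivAt.euclidean_apply
  have hB := hb.hasFDerivAt.euclidean_apply
  have hC := hc.hasFDerivAt.euclidean_apply
  have h := (((((hA 1).mul (hB 2)).sub ((hA 2).mul (hB 1))).mul (hC 0)).add
    ((((hA 2).mul (hB 0)).sub ((hA 0).mul (hB 2))).mul (hC 1))).add
    ((((hA 0).mul (hB 1)).sub ((hA 1).mul (hB 0))).mul (hC 2))
  have h' : HasFDerivAt (fun y => det3 (a y) (b y) (c y)) _ x :=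
    h.congr_of_eventuallyEq (.of_forall fun y => det3_eq _ _ _)
  rw [h'.fderiv]
  simp [det3_eq]
  ring

theorem ContDiff.det3 {E : Type*} [NormedAddCommGroup E] [NormedSpace ℝ E] {a b c : E → E3}
    {k : WithTop ℕ∞} (ha : ContDiff ℝ k a) (hb : ContDiff ℝ k b) (hc : ContDiff ℝ k c) :
    ContDiff ℝ k fun y => det3 (a y) (b y) (c y) := by
  simp only [det3_eq]
  fun_prop

theorem ContDiff.dot3 {E : Type*} [NormedAddCommGroup E] [NormedSpace ℝ E] {a b : E → E3}
    {k : WithTop ℕ∞} (ha : ContDiff ℝ k a) (hb : ContDiff ℝ k b) :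
    ContDiff ℝ k fun y => dot3 (a y) (b y) := by
  simp only [dot3_eq]
  fun_prop

theorem fderiv_dot3_self {E : Type*} [NormedAddCommGroup E] [NormedSpace ℝ E] {a : E → E3} {x : E}
    (ha : DifferentiableAt ℝ a x) (v : E) :
    fderiv ℝ (fun y => dot3 (a y) (a y)) x v = 2 * dot3 (fderiv ℝ a x v) (a x) := by
  have hA := ha.hasFDerivAt.euclidean_apply
  have h := (((hA 0).mul (hA 0)).add ((hA 1).mul (hA 1))).add ((hA 2).mul (hA 2))
  have h' : HasFDerivAt (fun y => dot3 (a y) (a y)) _ x :=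
    h.congr_of_eventuallyEq (.of_forall fun y => dot3_eq _ _)
  rw [h'.fderiv]
  simp [dot3_eq]
  ring

end Algebra

section SurfaceDivergence

variable {U K : Set E2} {F : E2 → E3}

theorem contDiff_indicator_of_eq_zero {E : Type*} [NormedAddCommGroup E] [NormedSpace ℝ E]
    {U K : Set E} (hU : IsOpen U) (hK : IsClosed K) (hKU : K ⊆ U) {f : E → ℝ} {k : WithTop ℕ∞}
    (hf : ContDiff ℝ k f) (h0 : ∀ x ∈ U \ K, f x = 0) : ContDiff ℝ k (U.indicator f) := by
  rw [contDiff_iff_contDiffAt]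
  intro x
  by_cases hx : x ∈ U
  · refine hf.contDiffAt.congr_of_eventuallyEq ?_
    filter_upwards [hU.mem_nhds hx] with y hy
    exact Set.indicator_of_mem hy f
  · refine (contDiffAt_const (c := (0 : ℝ))).congr_of_eventuallyEq ?_
    filter_upwards [hK.isOpen_compl.mem_nhds fun h => hx (hKU h)] with y hy
    by_cases hyU : y ∈ U
    · rw [Set.indicator_of_mem hyU, h0 y ⟨hyU, hy⟩]
    · exact Set.indicator_of_notMem hyU f

theorem setIntegral_mul_fderiv_eq_neg {E : Type*} [NormedAddCommGroup E] [NormedSpace ℝ E]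
    [FiniteDimensional ℝ E] [MeasurableSpace E] [BorelSpace E] (μ : Measure E) [μ.IsAddHaarMeasure]
    {U K : Set E} (hU : IsOpen U) (hK : IsCompact K) (hKU : K ⊆ U) {f g : E → ℝ}
    (hf : ContDiff ℝ 1 f) (hg : ContDiff ℝ 1 g) (h0 : ∀ x ∈ U \ K, f x = 0) (v : E) :
    IntegrableOn (fun x => f x * fderiv ℝ g x v) U μ ∧
    IntegrableOn (fun x => fderiv ℝ f x v * g x) U μ ∧
    ∫ x in U, f x * fderiv ℝ g x v ∂μ = -∫ x in U, fderiv ℝ f x v * g x ∂μ := by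
  set a := U.indicator f with ha_def
  have ha : ContDiff ℝ 1 a := contDiff_indicator_of_eq_zero hU hK.isClosed hKU hf h0
  have hsupp : ∀ x ∉ K, a x = 0 := fun x hx => by
    by_cases hxU : x ∈ U
    · rw [ha_def, Set.indicator_of_mem hxU, h0 x ⟨hxU, hx⟩]
    · exact Set.indicator_of_notMem hxU f
  have hcs : HasCompactSupport a := HasCompactSupport.intro hK hsupp
  have hfa : ∀ x ∈ U, fderiv ℝ a x = fderiv ℝ f x := fun x hx =>
    Filter.EventuallyEq.fderiv_eq (by
      filter_upwards [hU.mem_nhds hx] with y hy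
      exact Set.indicator_of_mem hy f)
  have hfa0 : ∀ x ∉ U, fderiv ℝ a x = 0 := fun x hx => by
    have : a =ᶠ[𝓝 x] fun _ => 0 := by
      filter_upwards [hK.isClosed.isOpen_compl.mem_nhds fun h => hx (hKU h)] with y hy
      exact hsupp y hy
    rw [this.fderiv_eq]
    simp
  have hca : Continuous fun x => fderiv ℝ a x v :=
    (ha.continuous_fderiv one_ne_zero).clm_apply continuous_const
  have hcg : Continuous fun x => fderiv ℝ g x v :=
    (hg.continuous_fderiv one_ne_zero).clm_apply continuous_const
  have hcs' : HasCompactSupport fun x => fderiv ℝ a x v := hcs.fderiv_apply ℝ v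
  have i1 : Integrable (fun x => a x * fderiv ℝ g x v) μ :=
    (ha.continuous.mul hcg).integrable_of_hasCompactSupport hcs.mul_right
  have i2 : Integrable (fun x => fderiv ℝ a x v * g x) μ :=
    (hca.mul hg.continuous).integrable_of_hasCompactSupport hcs'.mul_right
  have i3 : Integrable (fun x => a x * g x) μ :=
    (ha.continuous.mul hg.continuous).integrable_of_hasCompactSupport hcs.mul_right
  have key := integral_mul_fderiv_eq_neg_fderiv_mul_of_integrable i2 i1 i3
    (fun x _ => ha.differentiable one_ne_zero x) (fun x _ => hg.differentiable one_ne_zero x)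
  have e1 : (fun x => a x * fderiv ℝ g x v) = U.indicator fun x => f x * fderiv ℝ g x v := by
    ext x
    by_cases hx : x ∈ U <;> simp [ha_def, hx]
  have e2 : (fun x => fderiv ℝ a x v * g x) = U.indicator fun x => fderiv ℝ f x v * g x := by
    ext x
    by_cases hx : x ∈ U
    · simp [hx, hfa x hx]
    · simp [hx, hfa0 x hx]
  rw [e1] at i1 key
  rw [e2] at i2 key
  rw [integral_indicator hU.measurableSet, integral_indicator hU.measurableSet] at key
  exact ⟨(integrable_indicator_iff hU.measurableSet).1 i1,
    (integrable_indicator_iff hU.measurableSet).1 i2, key⟩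

/-- Integration by parts on a parametrized surface, pulled back to the parameter domain. -/
theorem setIntegral_tangentialTrace_mul_eq_neg (μ : Measure E2) [μ.IsAddHaarMeasure]
    (hU : IsOpen U) (hK : IsCompact K) (hKU : K ⊆ U) (hF : ContDiff ℝ 2 F)
    {n φ : E3 → E3} (hn : ContDiff ℝ 1 n) (hφ : ContDiff ℝ 1 φ) {ψ : E3 → ℝ}
    (hψ : ContDiff ℝ 1 ψ) {J : E2 → ℝ}
    (hcross : ∀ X ∈ U, cross3 (fderiv ℝ F X (EuclideanSpace.single 0 1))
      (fderiv ℝ F X (EuclideanSpace.single 1 1)) = J X • n (F X))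
    (hunit : ∀ X ∈ U, dot3 (n (F X)) (n (F X)) = 1) (hJ : ∀ X ∈ U, J X ≠ 0)
    (htan : ∀ X ∈ U, dot3 (φ (F X)) (n (F X)) = 0) (h0 : ∀ X ∈ U \ K, ψ (F X) = 0) :
    ∫ X in U, J X * (tangentialTrace (n (F X)) (fderiv ℝ φ (F X)) * ψ (F X)) ∂μ =
      -∫ X in U, J X * fderiv ℝ ψ (F X) (φ (F X)) ∂μ := by
  set e : Fin 2 → E2 := fun α => EuclideanSpace.single α 1 with he
  set g : Fin 2 → E2 → E3 := fun α X => fderiv ℝ F X (e α) with hg_def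
  have hF1 : ContDiff ℝ 1 F := hF.of_le one_le_two
  have hg : ∀ α, ContDiff ℝ 1 (g α) := fun α =>
    (hF.fderiv_right (m := 1) (by norm_num)).clm_apply contDiff_const
  have hφF : ContDiff ℝ 1 fun X => φ (F X) := hφ.comp hF1
  have hnF : ContDiff ℝ 1 fun X => n (F X) := hn.comp hF1
  have hψF : ContDiff ℝ 1 fun X => ψ (F X) := hψ.comp hF1
  have hcomp : ∀ {W : Type} [NormedAddCommGroup W] [NormedSpace ℝ W] {h : E3 → W},
      ContDiff ℝ 1 h → ∀ X α, fderiv ℝ (fun Y => h (F Y)) X (e α) = fderiv ℝ h (F X) (g α X) := by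
    intro W _ _ h hh X α
    have := fderiv_comp X (hh.differentiable one_ne_zero (F X)) (hF1.differentiable one_ne_zero X)
    rw [Function.comp_def] at this
    rw [this]
    rfl
  have hsymm : ∀ X, fderiv ℝ (g 1) X (e 0) = fderiv ℝ (g 0) X (e 1) := by
    intro X
    have hd : DifferentiableAt ℝ (fderiv ℝ F) X :=
      (hF.fderiv_right (m := 1) (by norm_num)).differentiable one_ne_zero X
    have hs : IsSymmSndFDerivAt ℝ F X := hF.contDiffAt.isSymmSndFDerivAt (by simp)
    have hα : ∀ α v, fderiv ℝ (g α) X v = fderiv ℝ (fderiv ℝ F) X v (e α) := by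
      intro α v
      rw [hg_def, fderiv_clm_apply hd (differentiableAt_const _)]
      simp
    rw [hα, hα]
    exact hs _ _
  have horth : ∀ X ∈ U, ∀ α, dot3 (g α X) (n (F X)) = 0 := by
    intro X hX α
    have h1 : dot3 (g α X) (cross3 (g 0 X) (g 1 X)) = 0 := by
      fin_cases α <;> simp [dot3_eq] <;> ring
    rw [hcross X hX] at h1
    have h2 : J X * dot3 (g α X) (n (F X)) = 0 := by
      rw [← h1]; simp [dot3_eq]; ring
    exact (mul_eq_zero.1 h2).resolve_left (hJ X hX)
  have hdn : ∀ X ∈ U, ∀ α, dot3 (fderiv ℝ (fun Y => n (F Y)) X (e α)) (n (F X)) = 0 := by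
    intro X hX α
    have h1 := fderiv_dot3_self (hnF.differentiable one_ne_zero X) (e α)
    have h2 : (fun Y => dot3 (n (F Y)) (n (F Y))) =ᶠ[𝓝 X] fun _ => 1 := by
      filter_upwards [hU.mem_nhds hX] with Y hY
      exact hunit Y hY
    rw [h2.fderiv_eq] at h1
    simp only [fderiv_fun_const, Pi.zero_apply, zero_apply] at h1
    linarith
  have hB0 : ContDiff ℝ 1 fun X => det3 (φ (F X)) (g 1 X) (n (F X)) := hφF.det3 (hg 1) hnF
  have hB1 : ContDiff ℝ 1 fun X => det3 (g 0 X) (φ (F X)) (n (F X)) := (hg 0).det3 hφF hnF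
  have hdiv : ∀ X ∈ U, fderiv ℝ (fun X => det3 (φ (F X)) (g 1 X) (n (F X))) X (e 0)
      + fderiv ℝ (fun X => det3 (g 0 X) (φ (F X)) (n (F X))) X (e 1)
      = J X * tangentialTrace (n (F X)) (fderiv ℝ φ (F X)) := by
    intro X hX
    rw [fderiv_det3 (hφF.differentiable one_ne_zero X) ((hg 1).differentiable one_ne_zero X)
      (hnF.differentiable one_ne_zero X),
      fderiv_det3 ((hg 0).differentiable one_ne_zero X) (hφF.differentiable one_ne_zero X)
      (hnF.differentiable one_ne_zero X), hsymm X,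
      det3_eq_zero_of_orthogonal (hunit X hX) (htan X hX) (horth X hX 1) (hdn X hX 0),
      det3_eq_zero_of_orthogonal (hunit X hX) (horth X hX 0) (htan X hX) (hdn X hX 1),
      hcomp hφ, hcomp hφ, ← det3_map_add_det3_map (hunit X hX) (hcross X hX)]
    simp only [det3_eq]
    ring
  have hgrad : ∀ X ∈ U, fderiv ℝ (fun X => ψ (F X)) X (e 0) * det3 (φ (F X)) (g 1 X) (n (F X))
      + fderiv ℝ (fun X => ψ (F X)) X (e 1) * det3 (g 0 X) (φ (F X)) (n (F X))
      = J X * fderiv ℝ ψ (F X) (φ (F X)) := by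
    intro X hX
    have := congrArg (fderiv ℝ ψ (F X))
      (det3_smul_add_det3_smul (hunit X hX) (hcross X hX) (htan X hX))
    simp only [map_add, map_smul, smul_eq_mul] at this
    rw [hcomp hψ, hcomp hψ, ← this]
    ring
  obtain ⟨i1, i2, h1⟩ := setIntegral_mul_fderiv_eq_neg μ hU hK hKU hψF hB0 h0 (e 0)
  obtain ⟨i3, i4, h2⟩ := setIntegral_mul_fderiv_eq_neg μ hU hK hKU hψF hB1 h0 (e 1)
  have hL : ∫ X in U, J X * (tangentialTrace (n (F X)) (fderiv ℝ φ (F X)) * ψ (F X)) ∂μ =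
      ∫ X in U, (ψ (F X) * fderiv ℝ (fun X => det3 (φ (F X)) (g 1 X) (n (F X))) X (e 0)
        + ψ (F X) * fderiv ℝ (fun X => det3 (g 0 X) (φ (F X)) (n (F X))) X (e 1)) ∂μ := by
    refine setIntegral_congr_fun hU.measurableSet fun X hX => ?_
    rw [← mul_add, hdiv X hX]
    ring
  have hR : ∫ X in U, J X * fderiv ℝ ψ (F X) (φ (F X)) ∂μ =
      ∫ X in U, (fderiv ℝ (fun X => ψ (F X)) X (e 0) * det3 (φ (F X)) (g 1 X) (n (F X))
      + fderiv ℝ (fun X => ψ (F X)) X (e 1) * det3 (g 0 X) (φ (F X)) (n (F X))) ∂μ :=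
    setIntegral_congr_fun hU.measurableSet fun X hX => (hgrad X hX).symm
  rw [hL, hR, integral_add i1 i3, integral_add i2 i4, h1, h2, neg_add]

theorem normDet_eq_norm_cross3 (L : E2 →L[ℝ] E3) :
    (L : E2 →ₗ[ℝ] E3).normDet =
      ‖cross3 (L (EuclideanSpace.single 0 1)) (L (EuclideanSpace.single 1 1))‖ := by
  rw [← sq_eq_sq₀ (LinearMap.normDet_nonneg _) (norm_nonneg _)]
  have h := (L : E2 →ₗ[ℝ] E3).normDet_sq_eq_det_gram (EuclideanSpace.basisFun (Fin 2) ℝ)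
  have h' : ((L : E2 →ₗ[ℝ] E3).normDet) ^ 2 = _ := h
  rw [h', Matrix.det_fin_two, ← dot3_self_eq_norm_sq]
  simp only [Matrix.gram_apply, inner_eq_dot3, EuclideanSpace.basisFun_apply,
    ContinuousLinearMap.coe_coe, dot3_eq, cross3_apply_zero, cross3_apply_one, cross3_apply_two]
  ring

theorem hausdorffMeasure_image_two_lt_top (hUb : Bornology.IsBounded U) (hF : ContDiff ℝ 1 F) :
    (μH[2] : Measure E3) (F '' U) < ∞ := by
  simpa using hausdorffMeasure_image_lt_top hUb hF

/-- Integration by parts on a parametrized surface, for tangential fields. -/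
theorem integral_tangentialTrace_mul_eq_neg (hU : IsOpen U) (hUb : Bornology.IsBounded U)
    (hK : IsCompact K) (hKU : K ⊆ U) (hF : ContDiff ℝ 2 F) (hinj : Set.InjOn F U)
    {n φ : E3 → E3} (hn : ContDiff ℝ 1 n) (hφ : ContDiff ℝ 1 φ) {ψ : E3 → ℝ}
    (hψ : ContDiff ℝ 1 ψ)
    (hcross : ∀ X ∈ U, cross3 (fderiv ℝ F X (EuclideanSpace.single 0 1))
      (fderiv ℝ F X (EuclideanSpace.single 1 1)) =
        ‖cross3 (fderiv ℝ F X (EuclideanSpace.single 0 1))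
          (fderiv ℝ F X (EuclideanSpace.single 1 1))‖ • n (F X))
    (hunit : ∀ X ∈ U, dot3 (n (F X)) (n (F X)) = 1)
    (hne : ∀ X ∈ U, cross3 (fderiv ℝ F X (EuclideanSpace.single 0 1))
      (fderiv ℝ F X (EuclideanSpace.single 1 1)) ≠ 0)
    (htan : ∀ X ∈ U, dot3 (φ (F X)) (n (F X)) = 0) (h0 : ∀ X ∈ U \ K, ψ (F X) = 0) :
    ∫ x in F '' U, tangentialTrace (n x) (fderiv ℝ φ x) * ψ x ∂(μH[2] : Measure E3) =
      -∫ x in F '' U, fderiv ℝ ψ x (φ x) ∂(μH[2] : Measure E3) := by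
  set J : E2 → ℝ := fun X => ‖cross3 (fderiv ℝ F X (EuclideanSpace.single 0 1))
    (fderiv ℝ F X (EuclideanSpace.single 1 1))‖ with hJ_def
  have hF1 : ContDiff ℝ 1 F := hF.of_le one_le_two
  have hg : ∀ α : Fin 2, Continuous fun X => fderiv ℝ F X (EuclideanSpace.single α 1) := fun α =>
    (hF1.continuous_fderiv one_ne_zero).clm_apply continuous_const
  have hJ : Continuous J := by
    refine Continuous.norm ?_
    unfold cross3
    refine (EuclideanSpace.equiv (Fin 3) ℝ).symm.continuous.comp (continuous_pi fun i => ?_)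
    have h0 := hg 0
    have h1 := hg 1
    fin_cases i <;> simp <;> fun_prop
  have himm : ∀ X ∈ U, Function.Injective (fderiv ℝ F X) := by
    intro X hX
    have h1 : (fderiv ℝ F X : E2 →ₗ[ℝ] E3).normDet ≠ 0 := by
      rw [normDet_eq_norm_cross3]
      exact norm_ne_zero_iff.2 (hne X hX)
    exact LinearMap.ker_eq_bot.1 (((fderiv ℝ F X : E2 →ₗ[ℝ] E3).normDet_ne_zero_tfae.out 0 1).1 h1)
  have hfr : (finrank ℝ E2 : ℝ) = 2 := by simp
  have area := fun f => integral_image_hausdorffMeasure hU hUb hF1 hinj himm hJ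
    (fun X _ => (normDet_eq_norm_cross3 _).symm) f
  rw [hfr] at area
  have : (μH[2] : Measure E2).IsAddHaarMeasure := by
    rw [← hfr]; infer_instance
  rw [area, area]
  exact setIntegral_tangentialTrace_mul_eq_neg _ hU hK hKU hF hn hφ hψ hcross hunit
    (fun X hX => norm_ne_zero_iff.2 (hne X hX)) htan h0

end SurfaceDivergence

section SurfaceGradient

variable {N : E3 × ℝ → E3} {t : ℝ}

theorem Gdet_eq_norm_cross3_sq (xh : E2 × ℝ → E3) (X : E2) (t : ℝ) :
    Gdet xh X t = ‖cross3 (gVec xh 0 X t) (gVec xh 1 X t)‖ ^ 2 := by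
  rw [← dot3_self_eq_norm_sq]
  simp only [Gdet, gMet, dot3_eq, cross3_apply_zero, cross3_apply_one, cross3_apply_two]
  ring

theorem dot3_smul_left (c : ℝ) (a b : E3) : dot3 (c • a) b = c * dot3 a b := by
  simp [dot3_eq]
  ring

theorem sgrad_apply (N : E3 × ℝ → E3) (f : E3 × ℝ → ℝ) (x : E3) (t : ℝ) (j : Fin 3) :
    sgrad N f x t j = tder N j f x t := rfl

theorem contDiff_sgrad {k m : WithTop ℕ∞} (hn : ContDiff ℝ k fun y => N (y, t)) {f : E3 × ℝ → ℝ}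
    (hf : ContDiff ℝ m fun y => f (y, t)) (hkm : k + 1 ≤ m) :
    ContDiff ℝ k fun x => sgrad N f x t := by
  refine contDiff_euclidean.2 fun j => ?_
  simp only [sgrad_apply, tder]
  have hn' := contDiff_euclidean.1 hn
  refine ContDiff.sum fun i _ => ContDiff.mul (contDiff_const.sub ((hn' i).mul (hn' j))) ?_
  exact (hf.fderiv_right hkm).clm_apply contDiff_const

theorem sgrad_add_const_mul {x : E3} {f h : E3 × ℝ → ℝ}
    (hf : DifferentiableAt ℝ (fun y => f (y, t)) x)
    (hh : DifferentiableAt ℝ (fun y => h (y, t)) x) (ε : ℝ) :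
    sgrad N (fun p => f p + ε * h p) x t = sgrad N f x t + ε • sgrad N h x t := by
  have hpd : ∀ i, pdx i (fun p => f p + ε * h p) x t = pdx i f x t + ε * pdx i h x t := by
    intro i
    simp only [pdx]
    rw [fderiv_fun_add hf (hh.const_mul ε), fderiv_const_mul hh]
    simp
  ext j
  simp only [PiLp.add_apply, PiLp.smul_apply, smul_eq_mul, sgrad_apply, tder, hpd,
    Fin.sum_univ_three]
  ring

theorem dot3_sgrad_normal {f : E3 × ℝ → ℝ} {x : E3} (hN : dot3 (N (x, t)) (N (x, t)) = 1) :
    dot3 (sgrad N f x t) (N (x, t)) = 0 := by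
  rw [dot3_eq] at hN
  simp only [dot3_eq, sgrad_apply, tder, Fin.sum_univ_three, Fin.isValue, reduceIte, Fin.reduceEq]
  linear_combination (-(N (x, t) 0 * pdx 0 f x t + N (x, t) 1 * pdx 1 f x t
    + N (x, t) 2 * pdx 2 f x t)) * hN

theorem dot3_sgrad_eq_fderiv {f : E3 × ℝ → ℝ} {x w : E3} (hw : dot3 w (N (x, t)) = 0) :
    dot3 w (sgrad N f x t) = fderiv ℝ (fun y => f (y, t)) x w := by
  have hpdx : ∀ i, fderiv ℝ (fun y => f (y, t)) x (EuclideanSpace.single i 1) = pdx i f x t :=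
    fun _ => rfl
  rw [clm_apply_eq_sum _ w]
  rw [dot3_eq] at hw
  simp only [dot3_eq, sgrad_apply, tder, Fin.sum_univ_three, Fin.isValue, reduceIte, Fin.reduceEq,
    smul_eq_mul, hpdx]
  linear_combination (-(N (x, t) 0 * pdx 0 f x t + N (x, t) 1 * pdx 1 f x t
    + N (x, t) 2 * pdx 2 f x t)) * hw

theorem sdiv_eq_tangentialTrace {φ : E3 × ℝ → E3} {x : E3}
    (hφ : DifferentiableAt ℝ (fun y => φ (y, t)) x) :
    sdiv N φ x t = tangentialTrace (N (x, t)) (fderiv ℝ (fun y => φ (y, t)) x) := by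
  have hpdx : ∀ i j, pdx i (fun p => φ p j) x t =
      fderiv ℝ (fun y => φ (y, t)) x (EuclideanSpace.single i 1) j := fun i j => by
    rw [pdx, (hφ.hasFDerivAt.euclidean_apply j).fderiv]
    rfl
  simp only [sdiv, tder, tangentialTrace, hpdx]

theorem hasDerivAt_setIntegral_dot3_line {S : Set E3} {μ : Measure E3} (hS : MeasurableSet S)
    (hSb : Bornology.IsBounded S) (hμ : μ S < ∞) {e : ℝ → ℝ} (he : ContDiff ℝ 1 e)
    {P Q : E3 → E3} (hP : Continuous P) (hQ : Continuous Q) :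
    HasDerivAt
      (fun ε : ℝ => ∫ x in S, (1 / 2) * e (dot3 (P x + ε • Q x) (P x + ε • Q x)) ∂μ)
      (∫ x in S, deriv e (dot3 (P x) (P x)) * dot3 (P x) (Q x) ∂μ) 0 := by
  have : IsFiniteMeasure (μ.restrict S) := ⟨by simpa using hμ⟩
  have hde : Continuous (deriv e) := he.continuous_deriv le_rfl
  have hdot : ∀ {X : Type} [TopologicalSpace X] {a b : X → E3}, Continuous a → Continuous b →
      Continuous fun x => dot3 (a x) (b x) := by
    intro X _ a b ha hb
    simp only [dot3_eq]
    fun_prop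
  have hline : Continuous fun p : ℝ × E3 => P p.2 + p.1 • Q p.2 := by fun_prop
  set f' : ℝ → E3 → ℝ := fun ε x =>
    deriv e (dot3 (P x + ε • Q x) (P x + ε • Q x)) * dot3 (P x + ε • Q x) (Q x) with hf'
  have hf : Continuous fun p : ℝ × E3 =>
      (1 / 2) * e (dot3 (P p.2 + p.1 • Q p.2) (P p.2 + p.1 • Q p.2)) :=
    continuous_const.mul (he.continuous.comp (hdot hline hline))
  have hf'c : Continuous fun p : ℝ × E3 => f' p.1 p.2 :=
    (hde.comp (hdot hline hline)).mul (hdot hline (hQ.comp continuous_snd))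
  have hslice : ∀ ε : ℝ, Continuous fun x : E3 => (ε, x) := fun ε => by fun_prop
  obtain ⟨R, hR⟩ := hSb.subset_closedBall 0
  obtain ⟨M, hM⟩ := ((isCompact_Icc (a := (-1 : ℝ)) (b := 1)).prod
    (isCompact_closedBall (0 : E3) R)).exists_bound_of_continuousOn hf'c.continuousOn
  obtain ⟨M₀, hM₀⟩ := (isCompact_closedBall (0 : E3) R).exists_bound_of_continuousOn
    (hf.comp (hslice 0)).continuousOn
  have hbase : Integrable (fun x => (1 / 2) * e (dot3 (P x + (0 : ℝ) • Q x) (P x + (0 : ℝ) • Q x)))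
      (μ.restrict S) := by
    refine Integrable.of_bound (hf.comp (hslice 0)).aestronglyMeasurable M₀ ?_
    filter_upwards [ae_restrict_mem hS] with x hx
    exact hM₀ x (hR hx)
  have key := (hasDerivAt_integral_of_dominated_loc_of_deriv_le (μ := μ.restrict S)
    (F := fun ε x => (1 / 2) * e (dot3 (P x + ε • Q x) (P x + ε • Q x))) (F' := f')
    (bound := fun _ => M) (x₀ := (0 : ℝ)) (s := Set.Icc (-1) 1)
    (Icc_mem_nhds (by norm_num) (by norm_num))
    (.of_forall fun ε => (hf.comp (hslice ε)).aestronglyMeasurable) hbase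
    (hf'c.comp (hslice 0)).aestronglyMeasurable ?_ (integrable_const M) ?_).2
  · simpa [hf'] using key
  · filter_upwards [ae_restrict_mem hS] with x hx ε hε
    exact hM (ε, x) ⟨hε, hR hx⟩
  · refine .of_forall fun x ε _ => ?_
    have hq : HasDerivAt (fun ε : ℝ => dot3 (P x + ε • Q x) (P x + ε • Q x))
        (2 * dot3 (P x + ε • Q x) (Q x)) ε := by
      have hc : ∀ i, HasDerivAt (fun ε : ℝ => P x i + ε * Q x i) (Q x i) ε := fun i => by
        simpa using ((hasDerivAt_id ε).mul_const (Q x i)).const_add (P x i)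
      have h := (((hc 0).mul (hc 0)).add ((hc 1).mul (hc 1))).add ((hc 2).mul (hc 2))
      refine (h.congr_of_eventuallyEq (.of_forall fun s => ?_)).congr_deriv ?_
      · simp [dot3_eq]
      · simp [dot3_eq]
        ring
    have he' := (he.differentiable one_ne_zero
      (dot3 (P x + ε • Q x) (P x + ε • Q x))).hasDerivAt
    refine ((he'.comp ε hq).const_mul (1 / 2)).congr_deriv ?_
    rw [hf']
    ring

end SurfaceGradient

/-- variation of the thermal dissipation energy `E_TD` with respect
to the temperature. -/
theorem variation_of_thermal_dissipation
    (T : ℝ) (hT : 0 < T)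
    (U : Set E2) (hUopen : IsOpen U) (hUne : U.Nonempty) (hUbd : Bornology.IsBounded U)
    (xh : E2 × ℝ → E3) (hxh : ContDiff ℝ 2 xh)
    (lam : ℝ) (hlam : 0 < lam)
    (hG : ∀ X ∈ U, ∀ t ∈ Set.Ico (0 : ℝ) T, lam ≤ Gdet xh X t)
    (hinj : ∀ t ∈ Set.Ico (0 : ℝ) T, Set.InjOn (fun X => xh (X, t)) U)
    (Γ : ℝ → Set E3) (hΓ : ∀ t, Γ t = (fun X => xh (X, t)) '' U)
    (N : E3 × ℝ → E3) (hN : ContDiff ℝ 1 N)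
    (hNs : ∀ X ∈ U, ∀ t ∈ Set.Ico (0 : ℝ) T, N (xh (X, t), t) = nHat xh X t)
    (e₃ : ℝ → ℝ) (he₃ : ContDiff ℝ 2 e₃)
    (θ : E3 × ℝ → ℝ) (hθ : ContDiff ℝ 2 θ)
    (t : ℝ) (ht : t ∈ Set.Ioo (0 : ℝ) T)
    (ψ : E3 → ℝ) (hψ : ContDiff ℝ 1 ψ)
    (K : Set E2) (hK : IsCompact K) (hKU : K ⊆ U)
    (hψsupp : ∀ X ∈ U \ K, ψ (xh (X, t)) = 0) :
    HasDerivAt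
      (fun ε : ℝ =>
        -(∫ x in Γ t,
            (1 / 2) * e₃ (dot3 (sgrad N (fun p => θ p + ε * ψ p.1) x t)
              (sgrad N (fun p => θ p + ε * ψ p.1) x t)) ∂(μH[2] : Measure E3)))
      (∫ x in Γ t,
        sdiv N
          (fun p => deriv e₃ (dot3 (sgrad N θ p.1 p.2) (sgrad N θ p.1 p.2))
            • sgrad N θ p.1 p.2) x t * ψ x ∂(μH[2] : Measure E3)) 0 := by
  have htI : t ∈ Set.Ico (0 : ℝ) T := ⟨ht.1.le, ht.2⟩
  set F : E2 → E3 := fun X => xh (X, t) with hF_def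
  have hslice : ContDiff ℝ 2 fun y : E3 => (y, t) := contDiff_prodMk_left t
  have hF : ContDiff ℝ 2 F := hxh.comp (contDiff_prodMk_left t)
  have hn : ContDiff ℝ 1 fun y => N (y, t) := hN.comp (contDiff_prodMk_left t)
  have hP : ContDiff ℝ 1 fun x => sgrad N θ x t :=
    contDiff_sgrad hn (hθ.comp hslice) (by norm_num)
  have hQ : Continuous fun x => sgrad N (fun p => ψ p.1) x t :=
    (contDiff_sgrad (k := 0) (hn.of_le zero_le_one) (f := fun p => ψ p.1) hψ (by simp)).continuous
  have hφ : ContDiff ℝ 1 fun x => deriv e₃ (dot3 (sgrad N θ x t) (sgrad N θ x t)) • sgrad N θ x t :=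
    ((he₃.iterate_deriv' 1 1).comp (hP.dot3 hP)).smul hP
  have hne : ∀ X ∈ U, cross3 (gVec xh 0 X t) (gVec xh 1 X t) ≠ 0 := by
    intro X hX h0
    have h1 := hG X hX t htI
    rw [Gdet_eq_norm_cross3_sq, h0] at h1
    norm_num at h1
    linarith
  have hcross : ∀ X ∈ U, cross3 (gVec xh 0 X t) (gVec xh 1 X t) =
      ‖cross3 (gVec xh 0 X t) (gVec xh 1 X t)‖ • N (F X, t) := by
    intro X hX
    rw [hNs X hX t htI, nHat, smul_smul, mul_inv_cancel₀ (norm_ne_zero_iff.2 (hne X hX)), one_smul]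
  have hunit : ∀ X ∈ U, dot3 (N (F X, t)) (N (F X, t)) = 1 := by
    intro X hX
    rw [dot3_self_eq_norm_sq, hNs X hX t htI, nHat, norm_smul, norm_inv, norm_norm,
      inv_mul_cancel₀ (norm_ne_zero_iff.2 (hne X hX)), one_pow]
  have hparts := integral_tangentialTrace_mul_eq_neg hUopen hUbd hK hKU hF (hinj t htI) hn hφ hψ
    hcross hunit hne
    (fun X hX => by rw [dot3_smul_left, dot3_sgrad_normal (hunit X hX), mul_zero]) hψsupp
  have hfin : (μH[2] : Measure E3) (F '' U) < ∞ :=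
    hausdorffMeasure_image_two_lt_top hUbd (hF.of_le one_le_two)
  have hbdd : Bornology.IsBounded (F '' U) :=
    (hUbd.isCompact_closure.image hF.continuous).isBounded.subset (Set.image_mono subset_closure)
  have hmeas : MeasurableSet (F '' U) :=
    hUopen.measurableSet.image_of_continuousOn_injOn hF.continuous.continuousOn (hinj t htI)
  have hder := hasDerivAt_setIntegral_dot3_line hmeas hbdd hfin (he₃.of_le one_le_two)
    hP.continuous hQ
  rw [hΓ t]
  have hlin : ∀ (ε : ℝ) (x : E3), sgrad N (fun p => θ p + ε * ψ p.1) x t =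
      sgrad N θ x t + ε • sgrad N (fun p => ψ p.1) x t := fun ε x =>
    sgrad_add_const_mul ((hθ.comp hslice).differentiable two_ne_zero x)
      (f := θ) (h := fun p => ψ p.1) (hψ.differentiable one_ne_zero x) ε
  simp only [hlin]
  refine hder.neg.congr_deriv (Eq.symm (Eq.trans ?_ (hparts.trans ?_)))
  · refine setIntegral_congr_fun hmeas fun x _ => ?_
    exact congrArg (· * ψ x) (sdiv_eq_tangentialTrace (hφ.differentiable one_ne_zero x))
  · congr 1
    refine setIntegral_congr_fun hmeas ?_
    rintro _ ⟨X, hX, rfl⟩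
    change fderiv ℝ ψ (F X) (deriv e₃ _ • sgrad N θ (F X) t) = _
    rw [map_smul, smul_eq_mul]
    congr 1
    exact (dot3_sgrad_eq_fderiv (f := fun p => ψ p.1) (dot3_sgrad_normal (hunit X hX))).symm
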